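/- For all integers m, n, p ≥ 6 and every x = (x₁,x₂,x₃) ∈ ℝ³, |ψ_{m,n,p}(x)| = |φ_m(x₁) φ_n(x₂) φ_p(x₃)| < 30³ · exp(‖x‖²/2) · √(mnp). -/

import Mathlib

open MeasureTheory Real

/-- Physicists' Hermite polynomials. -/
noncomputable def Hpoly : ℕ → ℝ → ℝ
  | 0 => fun _ => 1
  | 1 => fun t => 2 * t
  | n + 2 => fun t => 2 * t * Hpoly (n + 1) t - 2 * (n + 1) * Hpoly n t

/-- Eigenvalues `λ_n = a^(n+1/2)` with `a = 2/(2+√5)`. -/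
noncomputable def lam (n : ℕ) : ℝ := (2 / (2 + Real.sqrt 5)) ^ ((n : ℝ) + 1 / 2)

/-- Eigenfunctions `φ_n(t) = (b/√(2^n n!)) exp(-c t²) H_n(h t)` with
`b = 5^(1/8)`, `c = (√5-1)/2`, `h = 5^(1/4)`. -/
noncomputable def phi (n : ℕ) (t : ℝ) : ℝ :=
  ((5 : ℝ) ^ ((1 : ℝ) / 8) / Real.sqrt (2 ^ n * n.factorial)) *
    Real.exp (-((Real.sqrt 5 - 1) / 2) * t ^ 2) * Hpoly n ((5 : ℝ) ^ ((1 : ℝ) / 4) * t)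

/-- `τ_{m,n,p} = λ_m λ_n λ_p`. -/
noncomputable def tau (q : ℕ × ℕ × ℕ) : ℝ := lam q.1 * lam q.2.1 * lam q.2.2

/-- `ψ_{m,n,p}(x) = φ_m(x₁) φ_n(x₂) φ_p(x₃)`. -/
noncomputable def psi (q : ℕ × ℕ × ℕ) (x : EuclideanSpace ℝ (Fin 3)) : ℝ :=
  phi q.1 (x 0) * phi q.2.1 (x 1) * phi q.2.2 (x 2)

lemma Hpoly_add_two (n : ℕ) (t : ℝ) :
    Hpoly (n + 2) t = 2 * t * Hpoly (n + 1) t - 2 * (n + 1) * Hpoly n t := by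
  simp [Hpoly]

lemma hasDerivAt_Hpoly_succ (n : ℕ) (t : ℝ) :
    HasDerivAt (Hpoly (n + 1)) (2 * (n + 1) * Hpoly n t) t := by
  induction n using Nat.twoStepInduction with
  | zero => simpa [Hpoly] using (hasDerivAt_id t).const_mul 2
  | one =>
    have e : Hpoly (1 + 1) = fun s => 2 * s * (2 * s) - 2 := by ext s; simp [Hpoly]
    rw [e]
    refine ((((hasDerivAt_id t).const_mul 2).mul
      ((hasDerivAt_id t).const_mul 2)).sub_const 2).congr_deriv ?_
    simp [Hpoly]
    ring
  | more n ih1 ih2 =>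
    have e : Hpoly (n + 2 + 1) =
        fun s => 2 * s * Hpoly (n + 1 + 1) s - 2 * ((n : ℝ) + 2) * Hpoly (n + 1) s := by
      ext s
      rw [Hpoly_add_two (n + 1) s]
      push_cast
      ring
    rw [e]
    refine ((((hasDerivAt_id t).const_mul 2).mul ih2).sub
      (ih1.const_mul (2 * ((n : ℝ) + 2)))).congr_deriv ?_
    have := Hpoly_add_two n t
    push_cast
    simp only [id]
    linear_combination (-2) * ((n : ℝ) + 2) * this

lemma abs_Hpoly_neg (n : ℕ) (t : ℝ) : |Hpoly n (-t)| = |Hpoly n t| := by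
  have parity : Hpoly n (-t) = (-1) ^ n * Hpoly n t := by
    induction n using Nat.twoStepInduction with
    | zero => simp [Hpoly]
    | one => simp [Hpoly]
    | more n ih1 ih2 => rw [Hpoly_add_two, Hpoly_add_two, ih1, ih2]; ring
  rw [parity, abs_mul]
  simp

lemma Hpoly_zero_sq_le (n : ℕ) : Hpoly n 0 ^ 2 ≤ 2 ^ n * n.factorial := by
  induction n using Nat.twoStepInduction with
  | zero => simp [Hpoly]
  | one => simp [Hpoly]
  | more n ih _ =>
    rw [Hpoly_add_two, Nat.factorial_succ, Nat.factorial_succ]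
    push_cast
    have h1 : (0 : ℝ) ≤ 2 ^ n * n.factorial := by positivity
    have h2 : (0 : ℝ) ≤ 4 * ((n : ℝ) + 1) * (2 ^ n * n.factorial) := by positivity
    have h3 := mul_le_mul_of_nonneg_left ih (by positivity : (0 : ℝ) ≤ 4 * ((n : ℝ) + 1) ^ 2)
    calc _ = 4 * ((n : ℝ) + 1) ^ 2 * Hpoly n 0 ^ 2 := by ring
      _ ≤ _ := h3
      _ ≤ 4 * ((n : ℝ) + 1) ^ 2 * (2 ^ n * n.factorial) +
          4 * ((n : ℝ) + 1) * (2 ^ n * n.factorial) := by linarith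
      _ = _ := by ring

/-- Beyond `√(2n)` the Hermite polynomials up to degree `n + 1` are positive, and consecutive
ones grow by a factor of at least `y`. -/
lemma Hpoly_pos_and_mul_le {n k : ℕ} {y : ℝ} (hy : 0 < y) (hny : 2 * (n : ℝ) ≤ y ^ 2)
    (hk : k ≤ n) : 0 < Hpoly k y ∧ y * Hpoly k y ≤ Hpoly (k + 1) y := by
  induction k with
  | zero => simp [Hpoly]; linarith
  | succ k ih =>
    obtain ⟨h1, h2⟩ := ih (by omega)
    have h3 : (k : ℝ) + 1 ≤ n := by exact_mod_cast hk
    refine ⟨(mul_pos hy h1).trans_le h2, ?_⟩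
    rw [Hpoly_add_two]
    have h4 := mul_le_mul_of_nonneg_left h2 hy.le
    have h5 := mul_le_mul_of_nonneg_right (hny.trans' (by linarith : 2 * ((k : ℝ) + 1) ≤ _)) h1.le
    linarith

lemma hasDerivAt_exp_neg_sq (y : ℝ) :
    HasDerivAt (fun s : ℝ => exp (-s ^ 2)) (exp (-y ^ 2) * (-(2 * y))) y := by
  simpa using ((hasDerivAt_pow 2 y).neg).exp

/-- The Sonin-type energy `u'² + (2n + 1 - y²) u²` of the Hermite function
`u = exp(-y²/2) H_n(y)`, at index `n + 1`. -/
noncomputable def hermiteEnergy (n : ℕ) (y : ℝ) : ℝ :=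
  exp (-y ^ 2) * ((y * Hpoly (n + 1) y - Hpoly (n + 2) y) ^ 2 +
    (2 * n + 3 - y ^ 2) * Hpoly (n + 1) y ^ 2)

lemma hasDerivAt_hermiteEnergy (n : ℕ) (y : ℝ) :
    HasDerivAt (hermiteEnergy n) (-(2 * y * (exp (-y ^ 2) * Hpoly (n + 1) y ^ 2))) y := by
  have hB := hasDerivAt_Hpoly_succ n y
  have hC := hasDerivAt_Hpoly_succ (n + 1) y
  have h := (hasDerivAt_exp_neg_sq y).mul
    (((((hasDerivAt_id y).mul hB).sub hC).pow 2).add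
      (((hasDerivAt_pow 2 y).const_sub (2 * (n : ℝ) + 3)).mul (hB.pow 2)))
  refine h.congr_deriv ?_
  have := Hpoly_add_two n y
  simp [this]
  ring

lemma hermiteEnergy_le {n : ℕ} {y : ℝ} (hy : 0 ≤ y) :
    hermiteEnergy n y ≤ (4 * n + 7) * (2 ^ (n + 1) * (n + 1).factorial) := by
  have anti : AntitoneOn (hermiteEnergy n) (Set.Ici 0) := by
    refine antitoneOn_of_deriv_nonpos (convex_Ici 0)
      (fun z _ => (hasDerivAt_hermiteEnergy n z).continuousAt.continuousWithinAt)
      (fun z _ => (hasDerivAt_hermiteEnergy n z).differentiableAt.differentiableWithinAt)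
      fun z hz => ?_
    rw [interior_Ici] at hz
    have hz0 : 0 < z := hz
    rw [(hasDerivAt_hermiteEnergy n z).deriv, neg_nonpos]
    positivity
  refine (anti Set.self_mem_Ici hy hy).trans ?_
  have h1 := Hpoly_zero_sq_le (n + 1)
  have h2 := Hpoly_zero_sq_le (n + 2)
  rw [Nat.factorial_succ (n + 1)] at h2
  push_cast at h2
  have h3 := mul_le_mul_of_nonneg_left h1 (by positivity : (0 : ℝ) ≤ 2 * n + 3)
  calc hermiteEnergy n 0 = Hpoly (n + 2) 0 ^ 2 + (2 * n + 3) * Hpoly (n + 1) 0 ^ 2 := by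
        simp [hermiteEnergy]
    _ ≤ _ := add_le_add h2 h3
    _ = _ := by ring

lemma exp_mul_Hpoly_sq_le_of_sq_le {n : ℕ} {y : ℝ} (hy : 0 ≤ y) (hny : y ^ 2 ≤ 2 * n + 2) :
    exp (-y ^ 2) * Hpoly (n + 1) y ^ 2 ≤ (4 * n + 7) * (2 ^ (n + 1) * (n + 1).factorial) := by
  refine le_trans ?_ (hermiteEnergy_le hy)
  unfold hermiteEnergy
  gcongr
  nlinarith [sq_nonneg (y * Hpoly (n + 1) y - Hpoly (n + 2) y), sq_nonneg (Hpoly (n + 1) y)]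

lemma exp_mul_Hpoly_sq_antitoneOn (n : ℕ) :
    AntitoneOn (fun y => exp (-y ^ 2) * Hpoly (n + 1) y ^ 2) (Set.Ici √(2 * n + 2)) := by
  have hd (y : ℝ) := (hasDerivAt_exp_neg_sq y).mul ((hasDerivAt_Hpoly_succ n y).pow 2)
  refine antitoneOn_of_deriv_nonpos (convex_Ici _)
    (fun z _ => (hd z).continuousAt.continuousWithinAt)
    (fun z _ => (hd z).differentiableAt.differentiableWithinAt) fun z hz => ?_
  rw [interior_Ici] at hz
  have hz' : √(2 * n + 2) < z := hz
  have hz0 : 0 < z := (Real.sqrt_nonneg _).trans_lt hz'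
  have hz2 : 2 * (n : ℝ) + 2 ≤ z ^ 2 := ((Real.sqrt_lt' hz0).1 hz').le
  obtain ⟨hA, hAB⟩ := Hpoly_pos_and_mul_le (n := n) hz0 (by linarith) le_rfl
  have hB : 0 < Hpoly (n + 1) z := (mul_pos hz0 hA).trans_le hAB
  refine (hd z).deriv.trans_le ?_
  have key : 2 * ((n : ℝ) + 1) * Hpoly n z ≤ z * Hpoly (n + 1) z := by
    have h1 := mul_le_mul_of_nonneg_left hAB hz0.le
    have h2 := mul_le_mul_of_nonneg_right hz2 hA.le
    linarith
  have := mul_nonneg (mul_nonneg (exp_pos (-z ^ 2)).le hB.le) (sub_nonneg.2 key)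
  simp
  linarith

lemma exp_mul_Hpoly_sq_le (n : ℕ) (y : ℝ) :
    exp (-y ^ 2) * Hpoly (n + 1) y ^ 2 ≤ (4 * n + 7) * (2 ^ (n + 1) * (n + 1).factorial) := by
  wlog hy : 0 ≤ y generalizing y
  · have h := this (-y) (by linarith)
    rwa [neg_sq, ← sq_abs (Hpoly _ _), abs_Hpoly_neg, sq_abs] at h
  rcases le_total y √(2 * n + 2) with h | h
  · exact exp_mul_Hpoly_sq_le_of_sq_le hy ((Real.le_sqrt hy (by positivity)).1 h)
  · refine (exp_mul_Hpoly_sq_antitoneOn n Set.self_mem_Ici h h).trans ?_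
    exact exp_mul_Hpoly_sq_le_of_sq_le (Real.sqrt_nonneg _) (Real.sq_sqrt (by positivity)).le

lemma phi_sq (n : ℕ) (t : ℝ) :
    phi n t ^ 2 = (5 : ℝ) ^ ((1 : ℝ) / 4) * exp (t ^ 2) *
      (exp (-((5 : ℝ) ^ ((1 : ℝ) / 4) * t) ^ 2) * Hpoly n ((5 : ℝ) ^ ((1 : ℝ) / 4) * t) ^ 2 /
        (2 ^ n * n.factorial)) := by
  have h8 : ((5 : ℝ) ^ ((1 : ℝ) / 8)) ^ 2 = (5 : ℝ) ^ ((1 : ℝ) / 4) := by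
    rw [← Real.rpow_mul_natCast (by norm_num)]; norm_num
  have h4 : ((5 : ℝ) ^ ((1 : ℝ) / 4)) ^ 2 = √5 := by
    rw [← Real.rpow_mul_natCast (by norm_num), Real.sqrt_eq_rpow]; norm_num
  have hexp : exp (-((√5 - 1) / 2) * t ^ 2) ^ 2 =
      exp (t ^ 2) * exp (-((5 : ℝ) ^ ((1 : ℝ) / 4) * t) ^ 2) := by
    rw [← exp_add, ← exp_nat_mul, mul_pow, h4]
    congr 1
    push_cast
    ring
  have hs : √(2 ^ n * n.factorial : ℝ) ^ 2 = 2 ^ n * n.factorial := Real.sq_sqrt (by positivity)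
  unfold phi
  rw [mul_pow, mul_pow, div_pow, h8, hexp, hs]
  ring

lemma abs_phi_lt {n : ℕ} (hn : n ≠ 0) (t : ℝ) : |phi n t| < 30 * exp (t ^ 2 / 2) * √n := by
  obtain ⟨k, rfl⟩ := Nat.exists_eq_succ_of_ne_zero hn
  apply abs_lt_of_sq_lt_sq _ (by positivity)
  have h5 : (5 : ℝ) ^ ((1 : ℝ) / 4) ≤ 5 := Real.rpow_le_self_of_one_le (by norm_num) (by norm_num)
  have hq := (div_le_iff₀ (by positivity)).2 (exp_mul_Hpoly_sq_le k ((5 : ℝ) ^ ((1 : ℝ) / 4) * t))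
  have hE : exp (t ^ 2 / 2) ^ 2 = exp (t ^ 2) := by
    rw [← exp_nat_mul]; congr 1; push_cast; ring
  rw [phi_sq, mul_pow _ √_, mul_pow 30, hE, Real.sq_sqrt (by positivity)]
  calc _ ≤ 5 * exp (t ^ 2) * (4 * k + 7) := by gcongr
    _ = exp (t ^ 2) * (20 * k + 35) := by ring
    _ < exp (t ^ 2) * (900 * (k + 1)) := by gcongr ?_ * ?_; linarith [k.cast_nonneg (α := ℝ)]
    _ = _ := by push_cast; ring

/-- For `m, n, p ≥ 6` and `x ∈ ℝ³`,
`|ψ_{m,n,p}(x)| = |φ_m(x₁)φ_n(x₂)φ_p(x₃)| < 30³ exp(‖x‖²/2) √(mnp)`. -/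
theorem psi_bound (m n p : ℕ) (hm : 6 ≤ m) (hn : 6 ≤ n) (hp : 6 ≤ p)
    (x : EuclideanSpace ℝ (Fin 3)) :
    |psi (m, n, p) x| = |phi m (x 0) * phi n (x 1) * phi p (x 2)| ∧
    |psi (m, n, p) x| < 30 ^ 3 * Real.exp (‖x‖ ^ 2 / 2) * Real.sqrt (m * n * p) := by
  refine ⟨rfl, ?_⟩
  have h1 := abs_phi_lt (show m ≠ 0 by omega) (x 0)
  have h2 := abs_phi_lt (show n ≠ 0 by omega) (x 1)
  have h3 := abs_phi_lt (show p ≠ 0 by omega) (x 2)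
  calc |psi (m, n, p) x| = |phi m (x 0)| * |phi n (x 1)| * |phi p (x 2)| := by
        rw [psi, abs_mul, abs_mul]
    _ < (30 * exp (x 0 ^ 2 / 2) * √m) * (30 * exp (x 1 ^ 2 / 2) * √n) *
        (30 * exp (x 2 ^ 2 / 2) * √p) := by gcongr
    _ = 30 ^ 3 * (exp (x 0 ^ 2 / 2) * exp (x 1 ^ 2 / 2) * exp (x 2 ^ 2 / 2)) *
        (√m * √n * √p) := by ring
    _ = _ := by
        rw [← exp_add, ← exp_add, Real.sqrt_mul (by positivity), Real.sqrt_mul (by positivity),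
          EuclideanSpace.norm_sq_eq, Fin.sum_univ_three]
        simp only [Real.norm_eq_abs, sq_abs]
        congr 3
        ring
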